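/- Let K ⊂ ℝ² be a convex body with dim K = 2, and let K_s = (1/2)(K - K). Then 6 ≤ vol(K) · vol((K_s)*). -/

import Mathlib

open MeasureTheory Pointwise

/-- The polar body `K* = {y : ⟨x, y⟩ ≤ 1 for all x ∈ K}` with respect to the
standard inner product on `ℝ²`. -/
def polarBody {n : ℕ} (K : Set (Fin n → ℝ)) : Set (Fin n → ℝ) :=
  {y | ∀ x ∈ K, (∑ i, x i * y i) ≤ 1}

/-- A line through the origin splits the area of any planar set, measurable or not. -/
theorem volume_inter_halfPlane_add_le (D : Set (Fin 2 → ℝ)) {u : Fin 2 → ℝ} (hu : u ≠ 0) :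
    volume (D ∩ {x | 0 ≤ u 0 * x 0 + u 1 * x 1}) + volume (D ∩ {x | u 0 * x 0 + u 1 * x 1 ≤ 0})
      ≤ volume D := by
  let f : (Fin 2 → ℝ) →ₗ[ℝ] ℝ := u 0 • LinearMap.proj 0 + u 1 • LinearMap.proj 1
  have hfx (x : Fin 2 → ℝ) : f x = u 0 * x 0 + u 1 * x 1 := by simp [f]
  have hf : f ≠ 0 := by
    contrapose! hu
    have h (x : Fin 2 → ℝ) : u 0 * x 0 + u 1 * x 1 = 0 := by rw [← hfx, hu, LinearMap.zero_apply]
    ext i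
    fin_cases i
    · simpa using h ![1, 0]
    · simpa using h ![0, 1]
  simp only [← hfx]
  have hcont : Continuous f := f.continuous_of_finiteDimensional
  have hmeas : MeasurableSet {x | 0 ≤ f x} := (isClosed_le continuous_const hcont).measurableSet
  have hnull : volume (LinearMap.ker f : Set (Fin 2 → ℝ)) = 0 :=
    Measure.addHaar_submodule _ _ (by rwa [Ne, LinearMap.ker_eq_top])
  have hle : volume (D ∩ {x | f x ≤ 0}) ≤ volume (D \ {x | 0 ≤ f x}) := by
    calc volume (D ∩ {x | f x ≤ 0})
        ≤ volume ((D \ {x | 0 ≤ f x}) ∪ (LinearMap.ker f : Set (Fin 2 → ℝ))) := by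
          apply measure_mono
          rintro x ⟨hxD, hx⟩
          rcases eq_or_lt_of_le (show f x ≤ 0 from hx) with h | h
          · exact Or.inr h
          · exact Or.inl ⟨hxD, not_le.2 h⟩
      _ ≤ _ := (measure_union_le _ _).trans (by rw [hnull, add_zero])
  exact (add_le_add_right hle _).trans (measure_inter_add_sdiff D hmeas).le

theorem half_le_volume_unit_triangle :
    ENNReal.ofReal (1 / 2) ≤
      volume {x : Fin 2 → ℝ | 0 ≤ x 0 ∧ 0 ≤ x 1 ∧ x 0 + x 1 ≤ 1} := by
  set T := {x : Fin 2 → ℝ | 0 ≤ x 0 ∧ 0 ≤ x 1 ∧ x 0 + x 1 ≤ 1}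
  have hsq : volume (Set.Icc (0 : Fin 2 → ℝ) 1) = 1 := by
    rw [Real.volume_Icc_pi]; simp
  have hcov : Set.Icc (0 : Fin 2 → ℝ) 1 ⊆ T ∪ (fun x ↦ x + -1) ⁻¹' (-T) := by
    rintro x ⟨h0, h1⟩
    have a0 := h0 0
    have a1 := h0 1
    have b0 := h1 0
    have b1 := h1 1
    simp only [Pi.zero_apply, Pi.one_apply] at a0 a1 b0 b1
    by_cases h : x 0 + x 1 ≤ 1
    · exact Or.inl ⟨a0, a1, h⟩
    · refine Or.inr ⟨?_, ?_, ?_⟩ <;>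
        simp only [Pi.add_apply, Pi.neg_apply, Pi.one_apply] <;> linarith
  have hpre : volume ((fun x : Fin 2 → ℝ ↦ x + -1) ⁻¹' (-T)) = volume T := by
    rw [measure_preimage_add_right, Measure.measure_neg]
  have h2 : 1 ≤ volume T * 2 := by
    rw [mul_two, ← hsq]
    calc volume (Set.Icc (0 : Fin 2 → ℝ) 1)
        ≤ volume T + volume ((fun x : Fin 2 → ℝ ↦ x + -1) ⁻¹' (-T)) :=
          (measure_mono hcov).trans (measure_union_le _ _)
      _ = _ := by rw [hpre]
  rw [ENNReal.ofReal_div_of_pos two_pos, ENNReal.ofReal_one, ENNReal.ofReal_ofNat]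
  exact ENNReal.div_le_of_le_mul h2

theorem Convex.triangle_area_le_volume {D : Set (Fin 2 → ℝ)} (hD : Convex ℝ D) (h0 : 0 ∈ D)
    {v w : Fin 2 → ℝ} (hv : v ∈ D) (hw : w ∈ D) :
    ENNReal.ofReal (|v 0 * w 1 - v 1 * w 0| / 2) ≤ volume D := by
  let f := Matrix.toLin' !![v 0, w 0; v 1, w 1]
  set T := {x : Fin 2 → ℝ | 0 ≤ x 0 ∧ 0 ≤ x 1 ∧ x 0 + x 1 ≤ 1}
  have hsub : f '' T ⊆ D := by
    rintro _ ⟨x, ⟨hx0, hx1, hx⟩, rfl⟩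
    have hfx : f x = (1 - x 0 - x 1) • (0 : Fin 2 → ℝ) + x 0 • v + x 1 • w := by
      ext i
      fin_cases i <;> simp [f, Matrix.mulVec, dotProduct, Fin.sum_univ_two] <;> ring
    rw [hfx]
    have := hD.sum_mem (t := Finset.univ) (w := ![1 - x 0 - x 1, x 0, x 1]) (z := ![0, v, w])
      (by intro i _; fin_cases i <;> simp <;> linarith)
      (by simp only [Fin.sum_univ_three, Matrix.cons_val]; ring)
      (by intro i _; fin_cases i <;> simp [h0, hv, hw])
    simpa [Fin.sum_univ_three] using this
  have hdet : LinearMap.det f = v 0 * w 1 - v 1 * w 0 := by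
    rw [LinearMap.det_toLin', Matrix.det_fin_two_of]; ring
  calc ENNReal.ofReal (|v 0 * w 1 - v 1 * w 0| / 2)
      = ENNReal.ofReal |LinearMap.det f| * ENNReal.ofReal (1 / 2) := by
        rw [hdet, ← ENNReal.ofReal_mul (abs_nonneg _)]; ring_nf
    _ ≤ ENNReal.ofReal |LinearMap.det f| * volume T := by
        gcongr; exact half_le_volume_unit_triangle
    _ = volume (f '' T) := (Measure.addHaar_image_linearMap _ _ _).symm
    _ ≤ volume D := measure_mono hsub

theorem convex_halfPlane_nonneg (u : Fin 2 → ℝ) :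
    Convex ℝ {x : Fin 2 → ℝ | 0 ≤ u 0 * x 0 + u 1 * x 1} := by
  intro x hx y hy s t hs ht _
  simp only [Set.mem_ofPred_eq, Pi.add_apply, Pi.smul_apply, smul_eq_mul] at *
  nlinarith [mul_nonneg hs hx, mul_nonneg ht hy]

theorem convex_halfPlane_nonpos (u : Fin 2 → ℝ) :
    Convex ℝ {x : Fin 2 → ℝ | u 0 * x 0 + u 1 * x 1 ≤ 0} := by
  intro x hx y hy s t hs ht _
  simp only [Set.mem_ofPred_eq, Pi.add_apply, Pi.smul_apply, smul_eq_mul] at *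
  nlinarith [mul_nonneg hs (neg_nonneg.2 hx), mul_nonneg ht (neg_nonneg.2 hy)]

/-- The area of a convex set is at least half the product of the length of a chord and the
width orthogonally to it. -/
theorem Convex.chord_area_le_volume {D : Set (Fin 2 → ℝ)} (hD : Convex ℝ D) (h0 : 0 ∈ D)
    {v x y : Fin 2 → ℝ} (hv : v ∈ D) (hx : x ∈ D) (hy : y ∈ D) :
    ENNReal.ofReal (|v 0 * (x 1 - y 1) - v 1 * (x 0 - y 0)| / 2) ≤ volume D := by
  wlog hxy : v 0 * y 1 - v 1 * y 0 ≤ v 0 * x 1 - v 1 * x 0 generalizing x y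
  · rw [← abs_neg]
    convert this hy hx (le_of_not_ge hxy) using 4
    ring
  have habs : |v 0 * (x 1 - y 1) - v 1 * (x 0 - y 0)|
      = (v 0 * x 1 - v 1 * x 0) - (v 0 * y 1 - v 1 * y 0) := by
    rw [abs_of_nonneg (by linarith)]; ring
  rw [habs]
  by_cases hypos : 0 ≤ v 0 * y 1 - v 1 * y 0
  · refine le_trans (ENNReal.ofReal_le_ofReal ?_) (hD.triangle_area_le_volume h0 hv hx)
    linarith [le_abs_self (v 0 * x 1 - v 1 * x 0)]
  by_cases hxneg : v 0 * x 1 - v 1 * x 0 ≤ 0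
  · refine le_trans (ENNReal.ofReal_le_ofReal ?_) (hD.triangle_area_le_volume h0 hv hy)
    linarith [neg_le_abs (v 0 * y 1 - v 1 * y 0)]
  push Not at hypos hxneg
  have hu : ![-v 1, v 0] ≠ 0 := by
    intro h
    have h1 : v 1 = 0 := by simpa using congrFun h 0
    have h2 : v 0 = 0 := by simpa using congrFun h 1
    simp [h1, h2] at hxneg
  have hsplit := volume_inter_halfPlane_add_le D hu
  have hX := (hD.inter (convex_halfPlane_nonneg ![-v 1, v 0])).triangle_area_le_volume
    (v := v) (w := x) ⟨h0, by simp⟩ ⟨hv, by simp; linarith⟩ ⟨hx, by simp; linarith⟩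
  have hY := (hD.inter (convex_halfPlane_nonpos ![-v 1, v 0])).triangle_area_le_volume
    (v := v) (w := y) ⟨h0, by simp⟩ ⟨hv, by simp; linarith⟩ ⟨hy, by simp; linarith⟩
  refine le_trans ?_ ((add_le_add hX hY).trans hsplit)
  rw [abs_of_pos hxneg, abs_of_neg hypos, ← ENNReal.ofReal_add (by linarith) (by linarith)]
  exact ENNReal.ofReal_le_ofReal (by linarith)

theorem convex_polarBody {n : ℕ} (C : Set (Fin n → ℝ)) : Convex ℝ (polarBody C) := by
  intro y hy z hz s t hs ht hst x hx
  have h1 := mul_le_mul_of_nonneg_left (hy x hx) hs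
  have h2 := mul_le_mul_of_nonneg_left (hz x hx) ht
  calc ∑ i, x i * (s • y + t • z) i = s * ∑ i, x i * y i + t * ∑ i, x i * z i := by
        simp only [Finset.mul_sum, ← Finset.sum_add_distrib, Pi.add_apply, Pi.smul_apply,
          smul_eq_mul]
        exact Finset.sum_congr rfl fun i _ ↦ by ring
    _ ≤ 1 := by linarith

theorem zero_mem_polarBody {n : ℕ} (C : Set (Fin n → ℝ)) : 0 ∈ polarBody C := by
  intro x _; simp

theorem neg_polarBody {n : ℕ} {C : Set (Fin n → ℝ)} (hC : ∀ x ∈ C, -x ∈ C) :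
    -polarBody C = polarBody C := by
  have h {y : Fin n → ℝ} (hy : y ∈ polarBody C) : -y ∈ polarBody C := fun x hx ↦ by
    simpa using hy (-x) (hC x hx)
  ext y
  exact ⟨fun hy ↦ neg_neg y ▸ h hy, h⟩

theorem isBounded_polarBody {n : ℕ} {C : Set (Fin n → ℝ)} (hC : C ∈ nhds 0) :
    Bornology.IsBounded (polarBody C) := by
  obtain ⟨δ, hδ, hball⟩ := Metric.nhds_basis_closedBall.mem_iff.1 hC
  have key {y : Fin n → ℝ} (hy : y ∈ polarBody C) (i : Fin n) {t : ℝ} (ht : |t| ≤ δ) :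
      t * y i ≤ 1 := by
    have hmem : Pi.single i t ∈ C := hball <| by
      rw [mem_closedBall_zero_iff, Pi.norm_single, Real.norm_eq_abs]
      exact ht
    have := hy _ hmem
    simpa [Pi.single_apply, ite_mul] using this
  refine (Metric.isBounded_Icc (fun _ ↦ -(1 / δ)) (fun _ ↦ 1 / δ)).subset fun y hy ↦ ⟨?_, ?_⟩
  · intro i
    have h := key hy i (t := -δ) (by rw [abs_neg, abs_of_pos hδ])
    have : -y i ≤ 1 / δ := by rw [le_div_iff₀ hδ]; linarith
    linarith
  · intro i
    have h := key hy i (t := δ) (by rw [abs_of_pos hδ])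
    rw [le_div_iff₀ hδ]; linarith

/-- A boundary point has a supporting functional. -/
theorem exists_mem_polarBody_sum_eq_one {n : ℕ} {C : Set (Fin n → ℝ)} (hC : Convex ℝ C)
    (hC0 : C ∈ nhds 0) {u : Fin n → ℝ} (hu : gauge C u = 1) :
    ∃ p ∈ polarBody C, ∑ i, u i * p i = 1 := by
  obtain ⟨f, hf⟩ := geometric_hahn_banach_open_point hC.interior isOpen_interior
    (x := u) fun h ↦ ((gauge_lt_one_iff_mem_interior hC hC0).2 h).ne hu
  have hfu : 0 < f u := by simpa using hf 0 (mem_interior_iff_mem_nhds.2 hC0)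
  have hfx (x : Fin n → ℝ) : ∑ i, x i * (f (Pi.single i 1) / f u) = f x / f u := by
    conv_rhs => rw [pi_eq_sum_univ' x, map_sum, Finset.sum_div]
    refine Finset.sum_congr rfl fun i _ ↦ ?_
    rw [map_smul, smul_eq_mul, mul_div_assoc]
  refine ⟨fun i ↦ f (Pi.single i 1) / f u, fun x hx ↦ ?_, ?_⟩
  · rw [hfx, div_le_one hfu]
    have hcl : closure (interior C) ⊆ {z | f z ≤ f u} :=
      closure_minimal (fun z hz ↦ (hf z hz).le) (isClosed_le f.continuous continuous_const)
    apply hcl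
    rw [hC.closure_interior_eq_closure_of_nonempty_interior ⟨0, mem_interior_iff_mem_nhds.2 hC0⟩]
    exact subset_closure hx
  · rw [hfx, div_self hfu.ne']

/-- An affinely regular hexagon `±a, ±b, ±(a + b)` can be inscribed in a planar symmetric
convex body. -/
theorem exists_gauge_add_eq_one {C : Set (Fin 2 → ℝ)} (hC : Convex ℝ C) (hC0 : C ∈ nhds 0)
    (hbdd : Bornology.IsBounded C) (hsymm : ∀ x ∈ C, -x ∈ C) :
    ∃ a b : Fin 2 → ℝ, 0 < a 0 * b 1 - a 1 * b 0 ∧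
      gauge C a = 1 ∧ gauge C b = 1 ∧ gauge C (a + b) = 1 := by
  have hpos {x : Fin 2 → ℝ} (hx : x ≠ 0) : 0 < gauge C x :=
    (gauge_pos (absorbent_nhds_zero hC0) ((NormedSpace.isVonNBounded_iff ℝ).2 hbdd)).2 hx
  have hnormalize {x : Fin 2 → ℝ} (hx : x ≠ 0) : gauge C ((gauge C x)⁻¹ • x) = 1 := by
    rw [gauge_smul_of_nonneg (inv_nonneg.2 (gauge_nonneg _)), smul_eq_mul,
      inv_mul_cancel₀ (hpos hx).ne']
  obtain ⟨a, ha⟩ : ∃ a : Fin 2 → ℝ, gauge C a = 1 :=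
    ⟨_, hnormalize (x := ![1, 0]) fun h ↦ by simpa using congrFun h 0⟩
  have ha2 : 0 < a 0 ^ 2 + a 1 ^ 2 := by
    by_contra! h
    have h0 : a 0 = 0 := by nlinarith [sq_nonneg (a 0), sq_nonneg (a 1)]
    have h1 : a 1 = 0 := by nlinarith [sq_nonneg (a 0), sq_nonneg (a 1)]
    have : a = 0 := by ext i; fin_cases i <;> assumption
    simp [this] at ha
  let γ : ℝ → Fin 2 → ℝ := fun t ↦
    ![Real.cos t * a 0 - Real.sin t * a 1, Real.cos t * a 1 + Real.sin t * a 0]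
  have hγ : Continuous γ := by
    refine continuous_pi fun i ↦ ?_
    fin_cases i <;> simp [γ] <;> fun_prop
  have hγzero : γ 0 = a := by ext i; fin_cases i <;> simp [γ]
  have hγpi : γ Real.pi = -a := by ext i; fin_cases i <;> simp [γ]
  have hγ0 (t : ℝ) : γ t ≠ 0 := by
    intro h
    have h0 : Real.cos t * a 0 - Real.sin t * a 1 = 0 := congrFun h 0
    have h1 : Real.cos t * a 1 + Real.sin t * a 0 = 0 := congrFun h 1
    have : a 0 ^ 2 + a 1 ^ 2 = 0 := by
      calc a 0 ^ 2 + a 1 ^ 2 = (Real.sin t ^ 2 + Real.cos t ^ 2) * (a 0 ^ 2 + a 1 ^ 2) := by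
            rw [Real.sin_sq_add_cos_sq, one_mul]
        _ = (Real.cos t * a 0 - Real.sin t * a 1) ^ 2
            + (Real.cos t * a 1 + Real.sin t * a 0) ^ 2 := by ring
        _ = 0 := by rw [h0, h1]; ring
    linarith
  have hgc : Continuous (gauge C) := continuous_gauge hC hC0
  let b : ℝ → Fin 2 → ℝ := fun t ↦ (gauge C (γ t))⁻¹ • γ t
  have hb : Continuous b := ((hgc.comp hγ).inv₀ fun t ↦ (hpos (hγ0 t)).ne').smul hγ
  have hbzero : b 0 = a := by simp [b, hγzero, ha]
  have hbpi : b Real.pi = -a := by simp [b, hγpi, ha, gauge_neg hsymm]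
  have hF0 : gauge C (a + b 0) = 2 := by
    rw [hbzero, ← two_smul ℝ a, gauge_smul_of_nonneg zero_le_two, ha]; simp
  have hFpi : gauge C (a + b Real.pi) = 0 := by rw [hbpi, add_neg_cancel, gauge_zero]
  obtain ⟨t, ⟨ht0, htpi⟩, ht⟩ := intermediate_value_Icc' Real.pi_pos.le
    (f := fun t ↦ gauge C (a + b t)) (hgc.comp (continuous_const.add hb)).continuousOn
    (show (1 : ℝ) ∈ Set.Icc _ _ by rw [hF0, hFpi]; constructor <;> norm_num)
  have ht0' : 0 < t := lt_of_le_of_ne ht0 fun h ↦ by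
    rw [← h] at ht; linarith [ht.symm.trans hF0]
  have htpi' : t < Real.pi := lt_of_le_of_ne htpi fun h ↦ by
    rw [h] at ht; linarith [ht.symm.trans hFpi]
  refine ⟨a, b t, ?_, ha, hnormalize (hγ0 t), ht⟩
  have : a 0 * b t 1 - a 1 * b t 0
      = (gauge C (γ t))⁻¹ * (Real.sin t * (a 0 ^ 2 + a 1 ^ 2)) := by
    change a 0 * ((gauge C (γ t))⁻¹ * (Real.cos t * a 1 + Real.sin t * a 0))
      - a 1 * ((gauge C (γ t))⁻¹ * (Real.cos t * a 0 - Real.sin t * a 1)) = _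
    ring
  rw [this]
  exact mul_pos (inv_pos.2 (hpos (hγ0 t)))
    (mul_pos (Real.sin_pos_of_pos_of_lt_pi ht0' htpi') ha2)

/-- If a hexagon `±a, ±b, ±(a + b)` is inscribed in the symmetric set `C`, the polar of `C` has
area at least `3 r` as soon as it contains `r` times the hexagon rotated by a right angle. -/
theorem three_mul_le_volume_polarBody {C : Set (Fin 2 → ℝ)} (hC : Convex ℝ C) (hC0 : C ∈ nhds 0)
    (hclosed : IsClosed C) (hsymm : ∀ x ∈ C, -x ∈ C) {a b : Fin 2 → ℝ}
    (hab : 0 < a 0 * b 1 - a 1 * b 0) (ha : gauge C a = 1) (hb : gauge C b = 1)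
    (hc : gauge C (a + b) = 1) {r : ℝ} (hr : 0 ≤ r)
    (hrot : ∀ u ∈ ({a, b, a + b} : Set (Fin 2 → ℝ)), r • ![-u 1, u 0] ∈ polarBody C) :
    ENNReal.ofReal (3 * r) ≤ volume (polarBody C) := by
  have hmem {u : Fin 2 → ℝ} (hu : gauge C u = 1) : u ∈ C := by
    simpa [hclosed.closure_eq] using (gauge_le_one_iff_mem_closure hC hC0).1 hu.le
  have hne {u : Fin 2 → ℝ} (hu : gauge C u = 1) : u ≠ 0 := by rintro rfl; simp at hu
  set D := polarBody C
  have hD : Convex ℝ D := convex_polarBody C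
  have h0 : (0 : Fin 2 → ℝ) ∈ D := zero_mem_polarBody C
  have hnegD : -D = D := neg_polarBody hsymm
  have hneg {y : Fin 2 → ℝ} (hy : y ∈ D) : -y ∈ D := by rw [← hnegD]; simpa using hy
  have hpair {u y : Fin 2 → ℝ} (hu : gauge C u = 1) (hy : y ∈ D) :
      u 0 * y 0 + u 1 * y 1 ≤ 1 ∧ -1 ≤ u 0 * y 0 + u 1 * y 1 := by
    have h1 := hy u (hmem hu)
    have h2 := hy (-u) (hsymm u (hmem hu))
    simp only [Fin.sum_univ_two, Pi.neg_apply] at h1 h2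
    constructor <;> linarith
  have hJa : r • ![-a 1, a 0] ∈ D := hrot a (by simp)
  have hJb : r • ![-b 1, b 0] ∈ D := hrot b (by simp)
  have hJc : r • ![-(a + b) 1, (a + b) 0] ∈ D := hrot (a + b) (by simp)
  have hrab : 0 ≤ r * (a 0 * b 1 - a 1 * b 0) := mul_nonneg hr hab.le
  obtain ⟨p, hp, hpa⟩ := exists_mem_polarBody_sum_eq_one hC hC0 ha
  obtain ⟨q, hq, hqb⟩ := exists_mem_polarBody_sum_eq_one hC hC0 hb
  obtain ⟨s, hs, hsc⟩ := exists_mem_polarBody_sum_eq_one hC hC0 hc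
  rw [Fin.sum_univ_two] at hpa hqb hsc
  have hpb := hpair hb hp
  have hpc := hpair hc hp
  have hqa := hpair ha hq
  have hqc := hpair hc hq
  have hsa := hpair ha hs
  have hsb := hpair hb hs
  simp only [Pi.add_apply] at hpc hqc hsc
  let H := D ∩ {y | 0 ≤ (a + b) 0 * y 0 + (a + b) 1 * y 1}
  have hH : Convex ℝ H := hD.inter (convex_halfPlane_nonneg _)
  have hsector {E : Set (Fin 2 → ℝ)} (hE : Convex ℝ E) (h0 : 0 ∈ E) {v x y : Fin 2 → ℝ}
      (hv : v ∈ E) (hx : x ∈ E) (hy : y ∈ E)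
      (hval : v 0 * (x 1 - y 1) - v 1 * (x 0 - y 0) = r) : ENNReal.ofReal (r / 2) ≤ volume E := by
    simpa only [hval, abs_of_nonneg hr] using hE.chord_area_le_volume h0 hv hx hy
  have hS1 : ENNReal.ofReal (r / 2) ≤ volume (H ∩ {y | 0 ≤ a 0 * y 0 + a 1 * y 1} ∩
      {y | b 0 * y 0 + b 1 * y 1 ≤ 0}) := by
    refine hsector ((hH.inter (convex_halfPlane_nonneg _)).inter (convex_halfPlane_nonpos _))
      (v := p) (x := -(r • ![-b 1, b 0])) (y := -(r • ![-(a + b) 1, (a + b) 0]))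
      ⟨⟨⟨h0, ?_⟩, ?_⟩, ?_⟩ ⟨⟨⟨hp, ?_⟩, ?_⟩, ?_⟩ ⟨⟨⟨hneg hJb, ?_⟩, ?_⟩, ?_⟩
      ⟨⟨⟨hneg hJc, ?_⟩, ?_⟩, ?_⟩ ?_
    all_goals simp
    all_goals first | linarith | linear_combination r * hpa
  have hS2 : ENNReal.ofReal (r / 2) ≤ volume (H ∩ {y | 0 ≤ a 0 * y 0 + a 1 * y 1} ∩
      {y | 0 ≤ b 0 * y 0 + b 1 * y 1}) := by
    refine hsector ((hH.inter (convex_halfPlane_nonneg _)).inter (convex_halfPlane_nonneg _))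
      (v := s) (x := r • ![-a 1, a 0]) (y := -(r • ![-b 1, b 0]))
      ⟨⟨⟨h0, ?_⟩, ?_⟩, ?_⟩ ⟨⟨⟨hs, ?_⟩, ?_⟩, ?_⟩ ⟨⟨⟨hJa, ?_⟩, ?_⟩, ?_⟩
      ⟨⟨⟨hneg hJb, ?_⟩, ?_⟩, ?_⟩ ?_
    all_goals simp
    all_goals first | linarith | linear_combination r * hsc
  have hS3 : ENNReal.ofReal (r / 2) ≤ volume (H ∩ {y | a 0 * y 0 + a 1 * y 1 ≤ 0}) := by
    refine hsector (hH.inter (convex_halfPlane_nonpos _))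
      (v := q) (x := r • ![-(a + b) 1, (a + b) 0]) (y := r • ![-a 1, a 0])
      ⟨⟨h0, ?_⟩, ?_⟩ ⟨⟨hq, ?_⟩, ?_⟩ ⟨⟨hJc, ?_⟩, ?_⟩ ⟨⟨hJa, ?_⟩, ?_⟩ ?_
    all_goals simp
    all_goals first | linarith | linear_combination r * hqb
  have hvolH : ENNReal.ofReal (3 * r / 2) ≤ volume H := by
    refine le_trans ?_ (volume_inter_halfPlane_add_le H (hne ha))
    refine le_trans ?_ (add_le_add (volume_inter_halfPlane_add_le _ (hne hb)) le_rfl)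
    refine le_trans ?_ (add_le_add (add_le_add hS2 hS1) hS3)
    rw [← ENNReal.ofReal_add (by positivity) (by positivity),
      ← ENNReal.ofReal_add (by positivity) (by positivity)]
    exact ENNReal.ofReal_le_ofReal (by linarith)
  have hHneg : D ∩ {y | (a + b) 0 * y 0 + (a + b) 1 * y 1 ≤ 0} = -H := by
    rw [Set.inter_neg, hnegD]
    congr 1
    ext y
    simp only [Set.mem_ofPred_eq, Set.mem_neg, Pi.neg_apply]
    constructor <;> intro h <;> linarith
  refine le_trans ?_ (volume_inter_halfPlane_add_le D (hne hc))
  rw [hHneg, Measure.measure_neg]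
  refine le_trans ?_ (add_le_add hvolH hvolH)
  rw [← ENNReal.ofReal_add (by positivity) (by positivity)]
  exact ENNReal.ofReal_le_ofReal (by linarith)

/-- Eggleston: For a convex body `K ⊆ ℝ²` with `dim K = 2` and
the central symmetral `K_s = (1/2)(K - K)`, one has `6 ≤ vol K · vol (K_s)*`. -/
theorem stmt_14 (K : Set (Fin 2 → ℝ)) (hKconv : Convex ℝ K)
    (hKcomp : IsCompact K) (hKdim : (interior K).Nonempty) :
    (6 : ℝ) ≤ (volume K).toReal * (volume (polarBody ((2⁻¹ : ℝ) • (K - K)))).toReal := by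
  set C := (2⁻¹ : ℝ) • (K - K) with hCdef
  have hmemC {z : Fin 2 → ℝ} : z ∈ C ↔ ∃ x ∈ K, ∃ y ∈ K, (2⁻¹ : ℝ) • (x - y) = z := by
    simp only [hCdef, Set.mem_smul_set, Set.mem_sub]
    constructor
    · rintro ⟨_, ⟨x, hx, y, hy, rfl⟩, rfl⟩
      exact ⟨x, hx, y, hy, rfl⟩
    · rintro ⟨x, hx, y, hy, rfl⟩
      exact ⟨_, ⟨x, hx, y, hy, rfl⟩, rfl⟩
  have hC : Convex ℝ C := (hKconv.sub hKconv).smul _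
  have hCcomp : IsCompact C := (sub_eq_add_neg K K ▸ hKcomp.add hKcomp.neg).smul _
  have hsymm : ∀ z ∈ C, -z ∈ C := by
    intro z hz
    obtain ⟨x, hx, y, hy, rfl⟩ := hmemC.1 hz
    exact hmemC.2 ⟨y, hy, x, hx, by rw [← smul_neg, neg_sub]⟩
  have hC0 : C ∈ nhds 0 := by
    obtain ⟨x, hx⟩ := hKdim
    have hKK : K - K ∈ nhds (0 : Fin 2 → ℝ) :=
      Filter.mem_of_superset ((isOpen_interior.sub_right).mem_nhds
        (Set.mem_sub.2 ⟨x, hx, x, interior_subset hx, sub_self x⟩))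
        (Set.sub_subset_sub_right interior_subset)
    simpa using (set_smul_mem_nhds_zero_iff (s := K - K) (c := (2⁻¹ : ℝ)) (by norm_num)).2 hKK
  have hVtop : volume K ≠ ⊤ := hKcomp.measure_lt_top.ne
  have hVpos : 0 < (volume K).toReal :=
    ENNReal.toReal_pos (Measure.measure_pos_of_nonempty_interior _ hKdim).ne' hVtop
  have harea {u z : Fin 2 → ℝ} (hu : u ∈ C) (hz : z ∈ C) :
      2 * (u 0 * z 1 - u 1 * z 0) ≤ (volume K).toReal := by
    obtain ⟨v, hv, w, hw, rfl⟩ := hmemC.1 hu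
    obtain ⟨x, hx, y, hy, rfl⟩ := hmemC.1 hz
    have h := (hKconv.translate_preimage_left w).chord_area_le_volume (v := v - w) (x := x - w)
      (y := y - w) (by simpa) (by simpa) (by simpa) (by simpa)
    rw [measure_preimage_add_right, ENNReal.ofReal_le_iff_le_toReal hVtop] at h
    refine le_trans ?_ h
    refine le_trans (le_of_eq ?_) (div_le_div_of_nonneg_right (le_abs_self _) zero_le_two)
    simp only [Pi.smul_apply, Pi.sub_apply, smul_eq_mul]
    ring
  obtain ⟨a, b, hab, ha, hb, hc⟩ := exists_gauge_add_eq_one hC hC0 hCcomp.isBounded hsymm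
  have hgauge {u : Fin 2 → ℝ} (hu : gauge C u = 1) : u ∈ C := by
    simpa [hCcomp.isClosed.closure_eq] using (gauge_le_one_iff_mem_closure hC hC0).1 hu.le
  have hrot {u : Fin 2 → ℝ} (hu : u ∈ C) :
      (2 / (volume K).toReal) • ![-u 1, u 0] ∈ polarBody C := by
    intro z hz
    have h := harea hu hz
    calc ∑ i, z i * ((2 / (volume K).toReal) • ![-u 1, u 0]) i
        = 2 * (u 0 * z 1 - u 1 * z 0) / (volume K).toReal := by
          simp [Fin.sum_univ_two]; ring
      _ ≤ 1 := by rwa [div_le_one hVpos]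
  have hmain := three_mul_le_volume_polarBody hC hC0 hCcomp.isClosed hsymm hab ha hb hc
    (r := 2 / (volume K).toReal) (by positivity) (by
      rintro u (rfl | rfl | rfl)
      · exact hrot (hgauge ha)
      · exact hrot (hgauge hb)
      · exact hrot (hgauge hc))
  rw [ENNReal.ofReal_le_iff_le_toReal (isBounded_polarBody hC0).measure_lt_top.ne] at hmain
  calc (6 : ℝ) = (volume K).toReal * (3 * (2 / (volume K).toReal)) := by field_simp; norm_num
    _ ≤ _ := by gcongr
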